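/- Let H be a graph on h vertices and A ⊆ V(H) with |A| = a ≤ h/2 such that no triangle of H intersects A. Then e(H) ≤ C(h−2a, 2) + a(h−a). -/

import Mathlib

open scoped Classical

/-- The sum over `u ∈ S` of the number of neighbours of `u` in `S`,
that is, twice the number of edges spanned by `S`. -/
noncomputable def SimpleGraph.degreeSumOn {V : Type*} (H : SimpleGraph V) (S : Finset V) : ℕ :=
  ∑ u ∈ S, (S.filter (H.Adj u)).card

theorem SimpleGraph.degreeSumOn_insert {V : Type*} (H : SimpleGraph V) {S : Finset V} {x : V}
    (hx : x ∉ S) :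
    H.degreeSumOn (insert x S) = H.degreeSumOn S + 2 * (S.filter (H.Adj x)).card := by
  have hsum : ∑ u ∈ S, ((insert x S).filter (H.Adj u)).card
      = H.degreeSumOn S + (S.filter (H.Adj x)).card := by
    rw [SimpleGraph.degreeSumOn, Finset.card_filter (H.Adj x), ← Finset.sum_add_distrib]
    refine Finset.sum_congr rfl fun u _ => ?_
    rw [Finset.filter_insert, H.adj_comm x u]
    split_ifs
    · exact Finset.card_insert_of_notMem (by simp [hx])
    · rfl
  rw [SimpleGraph.degreeSumOn, Finset.sum_insert hx, hsum, Finset.filter_insert,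
    if_neg (H.loopless.irrefl x)]
  ring

theorem SimpleGraph.degreeSumOn_le_two_mul_choose {V : Type*} (H : SimpleGraph V) (S : Finset V) :
    H.degreeSumOn S ≤ 2 * S.card.choose 2 := by
  induction S using Finset.induction_on with
  | empty => simp [SimpleGraph.degreeSumOn]
  | insert x S hx ih =>
    rw [H.degreeSumOn_insert hx, Finset.card_insert_of_notMem hx, Nat.choose_succ_succ',
      Nat.choose_one_right]
    have := Finset.card_filter_le S (H.Adj x)
    lia

theorem SimpleGraph.degreeSumOn_insert_insert_le {V : Type*} (H : SimpleGraph V) {T : Finset V}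
    {x y : V} (hx : x ∉ insert y T) (hy : y ∉ T) (hxy : ∀ z ∈ T, H.Adj x z → ¬ H.Adj y z) :
    H.degreeSumOn (insert x (insert y T)) ≤ H.degreeSumOn T + 2 * (T.card + 1) := by
  rw [H.degreeSumOn_insert hx, H.degreeSumOn_insert hy]
  have hle : ((insert y T).filter (H.Adj x)).card ≤ (T.filter (H.Adj x)).card + 1 := by
    rw [Finset.filter_insert]
    split_ifs
    · exact Finset.card_insert_le _ _
    · exact Nat.le_succ _
  have hdisj : (T.filter (H.Adj x)).card + (T.filter (H.Adj y)).card ≤ T.card := by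
    rw [← Finset.card_union_of_disjoint (Finset.disjoint_filter.2 hxy)]
    exact Finset.card_le_card (Finset.union_subset (Finset.filter_subset _ _)
      (Finset.filter_subset _ _))
  lia

theorem SimpleGraph.degreeSumOn_le_of_no_triangle {V : Type*} (H : SimpleGraph V) (k : ℕ)
    (A S : Finset V) (hAS : A ⊆ S) (hS : S.card = 2 * A.card + k)
    (htri : ∀ x ∈ A, ∀ u v, H.Adj x u → H.Adj x v → ¬ H.Adj u v) :
    H.degreeSumOn S ≤ 2 * (k.choose 2 + A.card * (A.card + k)) := by
  induction hn : A.card generalizing A S with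
  | zero => simpa [hS, hn] using H.degreeSumOn_le_two_mul_choose S
  | succ n ih =>
    obtain ⟨x, hxA, y, hyS, hyA, hxy⟩ : ∃ x ∈ A, ∃ y ∈ S, y ∉ A ∧
        ∀ z ∈ S, H.Adj x z → ¬ H.Adj y z := by
      by_cases hcross : ∃ x ∈ A, ∃ y ∈ S, y ∉ A ∧ H.Adj x y
      · obtain ⟨x, hx, y, hy, hyA, hadj⟩ := hcross
        exact ⟨x, hx, y, hy, hyA, fun z _ hxz => htri x hx y z hadj hxz⟩
      · push Not at hcross
        obtain ⟨x, hx⟩ := Finset.card_pos.1 (by lia : 0 < A.card)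
        obtain ⟨y, hy, hyA⟩ := Finset.exists_mem_notMem_of_card_lt_card (by lia : A.card < S.card)
        refine ⟨x, hx, y, hy, hyA, fun z hz hxz hyz => ?_⟩
        by_cases hzA : z ∈ A
        · exact hcross z hzA y hy hyA hyz.symm
        · exact hcross x hx z hz hzA hxz
    have hne : x ≠ y := fun h => hyA (h ▸ hxA)
    set T := (S.erase x).erase y
    have hyT : insert y T = S.erase x :=
      Finset.insert_erase (Finset.mem_erase.2 ⟨hne.symm, hyS⟩)
    have hxT : insert x (insert y T) = S := by rw [hyT, Finset.insert_erase (hAS hxA)]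
    have hx : x ∉ insert y T := by simp [hyT]
    have hy : y ∉ T := Finset.notMem_erase _ _
    have hTcard : T.card + 2 = S.card := by
      rw [← hxT, Finset.card_insert_of_notMem hx, Finset.card_insert_of_notMem hy]
    have hAcard : (A.erase x).card = n := by rw [Finset.card_erase_of_mem hxA, hn]; rfl
    have hsub : A.erase x ⊆ T := fun z hz => by
      have := Finset.mem_erase.1 hz
      exact Finset.mem_erase.2 ⟨fun h => hyA (h ▸ this.2), Finset.mem_erase.2 ⟨this.1, hAS this.2⟩⟩
    have hind := ih (A.erase x) T hsub (by lia)
      (fun z hz => htri z (Finset.mem_of_mem_erase hz)) hAcard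
    have hstep := H.degreeSumOn_insert_insert_le hx hy
      (fun z hz => hxy z (Finset.mem_of_mem_erase (Finset.mem_of_mem_erase hz)))
    rw [hxT] at hstep
    have hTk : T.card = 2 * n + k := by lia
    rw [hTk] at hstep
    nlinarith

/-- If no triangle of `H` meets `A`, `|A| = a ≤ h/2`, then
`e(H) ≤ C(h−2a,2) + a(h−a)`. -/
theorem stmt9 {V : Type*} [Fintype V] (H : SimpleGraph V) (A : Finset V) (h a : ℕ)
    (hn : Fintype.card V = h) (ha : A.card = a) (hah : 2 * a ≤ h)
    (htri : ∀ t : Finset V, H.IsNClique 3 t → ∀ x ∈ A, x ∉ t) :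
    H.edgeFinset.card ≤ (h - 2 * a).choose 2 + a * (h - a) := by
  have hbound := H.degreeSumOn_le_of_no_triangle (h - 2 * a) A Finset.univ (Finset.subset_univ A)
    (by rw [Finset.card_univ]; lia) (fun x hx u v hxu hxv huv =>
      htri {x, u, v} (SimpleGraph.is3Clique_triple_iff.2 ⟨hxu, hxv, huv⟩) x hx (by simp))
  have hdeg : H.degreeSumOn Finset.univ = 2 * H.edgeFinset.card := by
    rw [← H.sum_degrees_eq_twice_card_edges]
    refine Finset.sum_congr rfl fun u _ => ?_
    rw [← H.card_neighborFinset_eq_degree, H.neighborFinset_eq_filter]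
  rw [hdeg, ha, show a + (h - 2 * a) = h - a by lia] at hbound
  lia
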